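/- For every prime p and every integer n ≥ 2, the identity ∑_{k=0}^{n−1} a_{n−1,p}(k)·p^k = a_{n,p} − a_{n−1,p} holds. -/

import Mathlib

open Finset Pointwise

/-- `a_{n,p}(k)` as the explicit sum `∑_{1≤i₁<⋯<i_k≤n} p^{i₁+⋯+i_k - k(k+1)/2}` over
increasing index tuples, encoded as `k`-element subsets of `{1, …, n}`. -/
def aFormula (p n k : ℕ) : ℕ :=
  ∑ s ∈ (Finset.Icc 1 n).powersetCard k, p ^ ((∑ i ∈ s, i) - k * (k + 1) / 2)

/-- `a_{n,p}(k)`: `1` if `k = 0` or `k = n`, and the explicit sum otherwise. -/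
def aNPK (p n k : ℕ) : ℕ := if k = 0 ∨ k = n then 1 else aFormula p n k

/-- `a_{n,p} = ∑_{k=0}^n a_{n,p}(k)`. -/
def aNP (p n : ℕ) : ℕ := ∑ k ∈ Finset.range (n + 1), aNPK p n k

theorem succ_mul_succ_succ_div_two (j : ℕ) :
    (j + 1) * (j + 1 + 1) / 2 = j * (j + 1) / 2 + (j + 1) := by
  rw [show (j + 1) * (j + 1 + 1) = j * (j + 1) + (j + 1) * 2 by ring,
    Nat.add_mul_div_right _ _ two_pos]

theorem card_mul_card_add_one_div_two_le_sum (s : Finset ℕ) (hs : 0 ∉ s) :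
    #s * (#s + 1) / 2 ≤ ∑ i ∈ s, i := by
  induction s using Finset.induction_on_max with
  | empty => simp
  | insert a s hlt ih =>
    have ha : a ∉ s := fun h => (hlt a h).false
    have hcard : #s + 1 ≤ a := by
      have hsub : insert a s ⊆ Finset.Icc 1 a := by
        intro x hx
        have hx0 : x ≠ 0 := fun h => hs (h ▸ hx)
        rcases Finset.mem_insert.1 hx with rfl | h
        · exact Finset.mem_Icc.2 ⟨Nat.pos_of_ne_zero hx0, le_rfl⟩
        · exact Finset.mem_Icc.2 ⟨Nat.pos_of_ne_zero hx0, (hlt x h).le⟩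
      simpa [Finset.card_insert_of_notMem ha] using Finset.card_le_card hsub
    have hsum := ih fun h => hs (Finset.mem_insert_of_mem h)
    rw [Finset.card_insert_of_notMem ha, Finset.sum_insert ha]
    have hdiv := succ_mul_succ_succ_div_two #s
    lia

theorem aFormula_zero_right (p n : ℕ) : aFormula p n 0 = 1 := by
  simp [aFormula]

theorem aFormula_self (p n : ℕ) : aFormula p n n = 1 := by
  have hsum : ∑ i ∈ Finset.Icc 1 n, i = n * (n + 1) / 2 := by
    have h := Finset.sum_range_id (n + 1)
    rw [Finset.range_eq_Ico, Finset.sum_eq_sum_Ico_succ_bot n.succ_pos] at h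
    simpa [mul_comm, Finset.Ico_add_one_right_eq_Icc] using h
  have hself : (Finset.Icc 1 n).powersetCard n = {Finset.Icc 1 n} := by
    simpa using Finset.powersetCard_self (Finset.Icc 1 n)
  simp [aFormula, hself, hsum]

theorem aFormula_eq_zero_of_lt {p n k : ℕ} (h : n < k) : aFormula p n k = 0 := by
  rw [aFormula, Finset.powersetCard_eq_empty.2 (by simpa using h), Finset.sum_empty]

theorem aNPK_eq_aFormula (p n k : ℕ) : aNPK p n k = aFormula p n k := by
  rw [aNPK]
  split_ifs with h
  · rcases h with rfl | rfl
    · exact (aFormula_zero_right p n).symm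
    · exact (aFormula_self p k).symm
  · rfl

/-- The `p`-analogue of Pascal's rule. -/
theorem aFormula_succ_succ (p n k : ℕ) :
    aFormula p (n + 1) (k + 1) = aFormula p n (k + 1) * p ^ (k + 1) + aFormula p n k := by
  have hIcc : Finset.Icc 1 (n + 1) =
      insert 1 ((Finset.Icc 1 n).map (addRightEmbedding 1)) := by
    rw [Finset.map_add_right_Icc]
    ext x
    simp only [Finset.mem_insert, Finset.mem_Icc]
    lia
  have hone : 1 ∉ (Finset.Icc 1 n).map (addRightEmbedding 1) := by
    simp
  have hshift (t : Finset ℕ) : ∑ i ∈ t.map (addRightEmbedding 1), i = ∑ i ∈ t, i + #t := by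
    simp [Finset.sum_add_distrib]
  have hdisj : Disjoint (((Finset.Icc 1 n).map (addRightEmbedding 1)).powersetCard (k + 1))
      ((((Finset.Icc 1 n).map (addRightEmbedding 1)).powersetCard k).image (insert 1)) := by
    rw [Finset.disjoint_left]
    intro s hs hs'
    obtain ⟨t, -, rfl⟩ := Finset.mem_image.1 hs'
    exact hone ((Finset.mem_powersetCard.1 hs).1 (Finset.mem_insert_self 1 t))
  have hnot {j : ℕ} {t : Finset ℕ}
      (ht : t ∈ ((Finset.Icc 1 n).map (addRightEmbedding 1)).powersetCard j) : 1 ∉ t :=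
    fun h => hone ((Finset.mem_powersetCard.1 ht).1 h)
  have hinj : Set.InjOn (insert 1)
      (((Finset.Icc 1 n).map (addRightEmbedding 1)).powersetCard k : Set (Finset ℕ)) := by
    intro s hs t ht hst
    rw [← Finset.erase_insert (hnot hs), ← Finset.erase_insert (hnot ht), hst]
  simp only [aFormula]
  rw [hIcc, Finset.powersetCard_succ_insert hone, Finset.sum_union hdisj, Finset.sum_image hinj,
    Finset.powersetCard_map, Finset.powersetCard_map, Finset.sum_map, Finset.sum_map,
    Finset.sum_mul]
  congr 1
  · refine Finset.sum_congr rfl fun t ht => ?_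
    obtain ⟨hsub, hcard⟩ := Finset.mem_powersetCard.1 ht
    have hle := card_mul_card_add_one_div_two_le_sum t fun h => by simpa using hsub h
    rw [hcard] at hle
    rw [← pow_add]
    congr 1
    change ∑ i ∈ t.map (addRightEmbedding 1), i - _ = _
    rw [hshift, hcard]
    lia
  · refine Finset.sum_congr rfl fun t ht => ?_
    obtain ⟨hsub, hcard⟩ := Finset.mem_powersetCard.1 ht
    have hmem : 1 ∉ t.map (addRightEmbedding 1) :=
      fun h => hone (Finset.map_subset_map.2 hsub h)
    congr 1
    change ∑ i ∈ insert 1 (t.map (addRightEmbedding 1)), i - _ = _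
    rw [Finset.sum_insert hmem, hshift, hcard, succ_mul_succ_succ_div_two]
    lia

/-- The identity `∑_{k=0}^{n−1} a_{n−1,p}(k)·p^k = a_{n,p} − a_{n−1,p}`. -/
theorem sum_aNPK_mul_pow (p n : ℕ) (hp : p.Prime) (hn : 2 ≤ n) :
    ∑ k ∈ Finset.range n, aNPK p (n - 1) k * p ^ k = aNP p n - aNP p (n - 1) := by
  obtain ⟨m, rfl⟩ : ∃ m, n = m + 1 := ⟨n - 1, by lia⟩
  simp only [aNP, aNPK_eq_aFormula, Nat.add_sub_cancel]
  refine (Nat.sub_eq_of_eq_add ?_).symm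
  rw [Finset.sum_range_succ' _ (m + 1)]
  simp only [aFormula_succ_succ, Finset.sum_add_distrib]
  have h := Finset.sum_range_succ' (fun k => aFormula p m k * p ^ k) (m + 1)
  rw [Finset.sum_range_succ, aFormula_eq_zero_of_lt m.lt_succ_self] at h
  simp only [aFormula_zero_right, pow_zero, zero_mul, add_zero, mul_one] at h ⊢
  rw [h]
  ring
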